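/- Let H be a finite simple graph on h vertices and let Π be a symmetric n×n matrix with entries in [0,1] and zero diagonal, where n ≥ h. Then Pr_{G∼G(Π)}[ |d(H;G) − E_{G∼G(Π)}[d(H;G)]| ≥ 1/√n ] ≤ 2·exp( − C(n,2) / (2n·C(h,2)²) ), where C(m,2) = m(m−1)/2. -/

import Mathlib

open Finset

open scoped Classical

/-- The induced density `d(H;G)`: the probability that a uniformly random
`|V(H)|`-element subset of `V(G)` induces a subgraph isomorphic to `H`. -/
noncomputable def inducedDensity {W V : Type*} [Fintype W] [Fintype V] [DecidableEq V]
    (H : SimpleGraph W) (G : SimpleGraph V) : ℝ :=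
  (((univ : Finset V).powersetCard (Fintype.card W)).filter
      (fun S => Nonempty (H ≃g G.induce (S : Set V)))).card /
    ((univ : Finset V).powersetCard (Fintype.card W)).card

/-- The number of edges of `G` spanned by the vertex set `S`. -/
noncomputable def edgesIn {V : Type*} [Fintype V] [DecidableEq V]
    (G : SimpleGraph V) (S : Finset V) : ℕ :=
  ((S.powersetCard 2).filter (fun T => ∀ x ∈ T, ∀ y ∈ T, x ≠ y → G.Adj x y)).card

/-- `localProfile G i = p_i(G)`: the probability that a uniformly random 3-element
subset of `V(G)` spans exactly `i` edges. -/
noncomputable def localProfile {V : Type*} [Fintype V] [DecidableEq V]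
    (G : SimpleGraph V) (i : ℕ) : ℝ :=
  (((univ : Finset V).powersetCard 3).filter (fun S => edgesIn G S = i)).card /
    ((univ : Finset V).powersetCard 3).card

/-- The probability that the random graph `G(Π)` (each pair `{i,j}` an edge independently
with probability `Π i j`) equals the graph `G`. -/
noncomputable def graphProb (n : ℕ) (P : Fin n → Fin n → ℝ) (G : SimpleGraph (Fin n)) : ℝ :=
  ∏ p ∈ (univ : Finset (Fin n × Fin n)).filter (fun p => p.1 < p.2),
    (if G.Adj p.1 p.2 then P p.1 p.2 else 1 - P p.1 p.2)

/-- The expected induced density `E_{G ∼ G(Π)}[d(H;G)]`. -/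
noncomputable def expDensity {W : Type*} [Fintype W] (n : ℕ) (P : Fin n → Fin n → ℝ)
    (H : SimpleGraph W) : ℝ :=
  ∑ G : SimpleGraph (Fin n), graphProb n P G * inducedDensity H G

/-- The probability of the event `E` under the random graph `G(Π)`. -/
noncomputable def eventProb (n : ℕ) (P : Fin n → Fin n → ℝ)
    (E : SimpleGraph (Fin n) → Prop) : ℝ :=
  ∑ G ∈ (univ : Finset (SimpleGraph (Fin n))).filter E, graphProb n P G

/-- product weight -/
noncomputable def bw {α : Type*} (p : α → ℝ) (E A : Finset α) : ℝ :=
  ∏ e ∈ E, (if e ∈ A then p e else 1 - p e)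

lemma bw_nonneg {α : Type*} (p : α → ℝ) (hp : ∀ e, p e ∈ Set.Icc (0 : ℝ) 1) (E A : Finset α) :
    0 ≤ bw p E A := by
  refine prod_nonneg fun e _ => ?_
  have := hp e
  split_ifs
  · exact this.1
  · linarith [this.2]

lemma bw_sum_insert {α : Type*} (p : α → ℝ) (a : α) (E : Finset α) (ha : a ∉ E)
    (F : Finset α → ℝ) :
    ∑ A ∈ (insert a E).powerset, bw p (insert a E) A * F A =
      (1 - p a) * ∑ A ∈ E.powerset, bw p E A * F A +
      p a * ∑ A ∈ E.powerset, bw p E A * F (insert a A) := by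
  rw [sum_powerset_insert ha, mul_sum, mul_sum]
  congr 1
  · refine sum_congr rfl fun A hA => ?_
    have hA' : a ∉ A := fun h => ha (mem_powerset.1 hA h)
    simp only [bw]
    rw [prod_insert ha, if_neg hA', mul_assoc]
  · refine sum_congr rfl fun A hA => ?_
    simp only [bw]
    rw [prod_insert ha, if_pos (mem_insert_self _ _), mul_assoc]
    congr 2
    refine prod_congr rfl fun e he => ?_
    have : e ≠ a := fun h => ha (h ▸ he)
    simp [this]

lemma bw_sum_one {α : Type*} (p : α → ℝ) (E : Finset α) :
    ∑ A ∈ E.powerset, bw p E A = 1 := by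
  induction E using Finset.induction_on with
  | empty => simp [bw]
  | insert a E ha ih =>
    have := bw_sum_insert p a E ha (fun _ => 1)
    simp only [mul_one, ih] at this
    rw [this]; ring

lemma exp_le_chord (l x : ℝ) (hx : |x| ≤ 1) :
    Real.exp (l * x) ≤ Real.cosh l + x * Real.sinh l := by
  have h := abs_le.1 hx
  have := convexOn_exp.2 (Set.mem_univ l) (Set.mem_univ (-l))
    (show 0 ≤ (1 + x) / 2 by linarith) (show 0 ≤ (1 - x) / 2 by linarith) (by ring)
  simp only [smul_eq_mul] at this
  rw [Real.cosh_eq, Real.sinh_eq]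
  calc _ = Real.exp ((1 + x) / 2 * l + (1 - x) / 2 * -l) := by ring_nf
    _ ≤ _ := this
    _ = _ := by ring

lemma two_point (q : ℝ) (hq : q ∈ Set.Icc (0 : ℝ) 1) (s c u v : ℝ) (h : |v - u| ≤ c) :
    (1 - q) * Real.exp (s * (u - ((1 - q) * u + q * v))) +
      q * Real.exp (s * (v - ((1 - q) * u + q * v))) ≤ Real.exp (s ^ 2 * c ^ 2 / 2) := by
  obtain ⟨h0, h1⟩ := hq
  have e1 := exp_le_chord (s * (v - u)) (-q) (abs_le.2 ⟨by linarith, by linarith⟩)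
  have e2 := exp_le_chord (s * (v - u)) (1 - q) (abs_le.2 ⟨by linarith, by linarith⟩)
  have e3 := Real.cosh_le_exp_half_sq (s * (v - u))
  have e4 : (s * (v - u)) ^ 2 / 2 ≤ s ^ 2 * c ^ 2 / 2 := by
    have : (v - u) ^ 2 ≤ c ^ 2 := by
      rw [← sq_abs]; exact pow_le_pow_left₀ (abs_nonneg _) h 2
    rw [mul_pow]; gcongr
  have e5 := Real.exp_le_exp.2 e4
  rw [show s * (u - ((1 - q) * u + q * v)) = s * (v - u) * (-q) by ring,
    show s * (v - ((1 - q) * u + q * v)) = s * (v - u) * (1 - q) by ring]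
  have f1 := mul_le_mul_of_nonneg_left e1 (show 0 ≤ 1 - q by linarith)
  have f2 := mul_le_mul_of_nonneg_left e2 h0
  nlinarith

lemma mgf_bound {α : Type*} (p : α → ℝ) (hp : ∀ e, p e ∈ Set.Icc (0 : ℝ) 1) (s c : ℝ)
    (E : Finset α) : ∀ (f : Finset α → ℝ)
    (_ : ∀ e ∈ E, ∀ A ⊆ E, |f (insert e A) - f A| ≤ c),
    ∑ A ∈ E.powerset, bw p E A * Real.exp (s * (f A - ∑ B ∈ E.powerset, bw p E B * f B)) ≤
      Real.exp (E.card * (s ^ 2 * c ^ 2 / 2)) := by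
  induction E using Finset.induction_on with
  | empty => intro f _; simp [bw]
  | insert a E ha ih =>
    intro f hf
    have i0 := ih f (fun e he A hA => hf e (mem_insert_of_mem he) A
      (hA.trans (subset_insert _ _)))
    have i1 := ih (fun A => f (insert a A)) (fun e he A hA => by
      have := hf e (mem_insert_of_mem he) (insert a A) (insert_subset_insert _ hA)
      rwa [Finset.insert_comm] at this)
    rw [bw_sum_insert p a E ha f,
      bw_sum_insert p a E ha (fun A => Real.exp (s * (f A - _)))]
    set u := ∑ B ∈ E.powerset, bw p E B * f B with hu
    set v := ∑ B ∈ E.powerset, bw p E B * f (insert a B) with hv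
    have huv : |v - u| ≤ c := by
      rw [hu, hv, ← sum_sub_distrib]
      calc _ ≤ ∑ B ∈ E.powerset, |bw p E B * f (insert a B) - bw p E B * f B| :=
            abs_sum_le_sum_abs _ _
        _ ≤ ∑ B ∈ E.powerset, bw p E B * c := by
            refine sum_le_sum fun B hB => ?_
            rw [← mul_sub, abs_mul, abs_of_nonneg (bw_nonneg p hp E B)]
            exact mul_le_mul_of_nonneg_left (hf a (mem_insert_self _ _) B
              ((mem_powerset.1 hB).trans (subset_insert _ _))) (bw_nonneg p hp E B)
        _ = c := by rw [← sum_mul, bw_sum_one, one_mul]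
    have tp := two_point (p a) (hp a) s c u v huv
    set m := (1 - p a) * u + p a * v with hm
    have shift : ∀ (g : Finset α → ℝ) (w : ℝ),
        ∑ A ∈ E.powerset, bw p E A * Real.exp (s * (g A - m)) =
        Real.exp (s * (w - m)) * ∑ A ∈ E.powerset, bw p E A * Real.exp (s * (g A - w)) := by
      intro g w
      rw [mul_sum]
      refine sum_congr rfl fun A _ => ?_
      rw [mul_left_comm, ← Real.exp_add]
      ring_nf
    rw [shift f u, shift (fun A => f (insert a A)) v, card_insert_of_notMem ha]
    have hq0 := (hp a).1
    have hq1 := (hp a).2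
    set K := Real.exp (E.card * (s ^ 2 * c ^ 2 / 2)) with hK
    have hK0 : 0 ≤ K := (Real.exp_pos _).le
    calc _ ≤ (1 - p a) * (Real.exp (s * (u - m)) * K) + p a * (Real.exp (s * (v - m)) * K) := by
          have : 0 ≤ 1 - p a := by linarith
          gcongr
      _ = ((1 - p a) * Real.exp (s * (u - m)) + p a * Real.exp (s * (v - m))) * K := by ring
      _ ≤ Real.exp (s ^ 2 * c ^ 2 / 2) * K := by gcongr
      _ = _ := by
          rw [hK, ← Real.exp_add]; push_cast; ring_nf

lemma card_pairs (n : ℕ) :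
    ((univ : Finset (Fin n × Fin n)).filter (fun p => p.1 < p.2)).card = n.choose 2 := by
  have h1 := Finset.card_powersetCard 2 (univ : Finset (Fin n))
  rw [card_univ, Fintype.card_fin] at h1
  rw [← h1]
  refine card_bij (fun p _ => {p.1, p.2}) ?_ ?_ ?_
  · intro p hp
    simp only [mem_filter, mem_univ, true_and] at hp
    simp [mem_powersetCard, card_pair hp.ne]
  · rintro ⟨a, b⟩ hp ⟨c, d⟩ hq he
    simp only [mem_filter, mem_univ, true_and] at hp hq
    have ha : a ∈ ({c, d} : Finset (Fin n)) := by rw [← he]; simp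
    have hb : b ∈ ({c, d} : Finset (Fin n)) := by rw [← he]; simp
    simp only [mem_insert, mem_singleton] at ha hb
    ext <;> grind
  · intro S hS
    obtain ⟨x, y, hxy, rfl⟩ := card_eq_two.1 (mem_powersetCard.1 hS).2
    rcases lt_or_gt_of_ne hxy with h | h
    · exact ⟨(x, y), by simpa using h, rfl⟩
    · exact ⟨(y, x), by simpa using h, pair_comm _ _⟩

lemma graph_sum (n : ℕ) (P : Fin n → Fin n → ℝ) (F : SimpleGraph (Fin n) → ℝ) :
    ∑ G, graphProb n P G * F G =
      ∑ A ∈ ((univ : Finset (Fin n × Fin n)).filter (fun p => p.1 < p.2)).powerset,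
        bw (fun p => P p.1 p.2) ((univ : Finset (Fin n × Fin n)).filter (fun p => p.1 < p.2)) A *
          F (SimpleGraph.fromRel (fun x y => (x, y) ∈ A)) := by
  symm
  refine sum_bij' (fun A _ => SimpleGraph.fromRel (fun x y => (x, y) ∈ A))
    (fun G _ => (univ : Finset (Fin n × Fin n)).filter (fun p => p.1 < p.2 ∧ G.Adj p.1 p.2))
    ?_ ?_ ?_ ?_ ?_
  · simp
  · intro G _
    simp only [mem_powerset]
    intro p hp
    simp only [mem_filter, mem_univ, true_and] at hp ⊢
    exact hp.1
  · intro A hA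
    ext ⟨x, y⟩
    simp only [mem_filter, mem_univ, true_and, SimpleGraph.fromRel_adj]
    have key : ∀ x y, (x, y) ∈ A → x < y := fun x y h => by
      simpa using mem_powerset.1 hA h
    constructor
    · rintro ⟨h1, h2, h3 | h3⟩
      · exact h3
      · exact absurd (key _ _ h3) h1.asymm
    · intro h
      exact ⟨key _ _ h, (key _ _ h).ne, Or.inl h⟩
  · intro G _
    ext x y
    simp only [mem_filter, mem_univ, true_and, SimpleGraph.fromRel_adj]
    constructor
    · rintro ⟨h1, h2 | h2⟩
      · exact h2.2
      · exact h2.2.symm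
    · intro h
      refine ⟨h.ne, ?_⟩
      rcases lt_or_gt_of_ne h.ne with h1 | h1
      · exact Or.inl ⟨h1, h⟩
      · exact Or.inr ⟨h1, h.symm⟩
  · intro A hA
    congr 1
    have key : ∀ x y, (x, y) ∈ A → x < y := fun x y h => by
      simpa using mem_powerset.1 hA h
    simp only [bw, graphProb]
    refine prod_congr rfl fun p hp => ?_
    have hlt : p.1 < p.2 := by simpa using hp
    have : (SimpleGraph.fromRel (fun x y => (x, y) ∈ A)).Adj p.1 p.2 ↔ p ∈ A := by
      simp only [SimpleGraph.fromRel_adj]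
      constructor
      · rintro ⟨_, h | h⟩
        · exact h
        · exact absurd (key _ _ h) hlt.asymm
      · intro h
        exact ⟨hlt.ne, Or.inl h⟩
    simp only [this]

lemma card_containing (n h : ℕ) (x y : Fin n) (hxy : x ≠ y) :
    (((univ : Finset (Fin n)).powersetCard h).filter (fun S => x ∈ S ∧ y ∈ S)).card ≤
      (n - 2).choose (h - 2) := by
  have hc : ((univ : Finset (Fin n)) \ {x, y}).card = n - 2 := by
    rw [card_sdiff_of_subset (subset_univ _), card_pair hxy, card_univ, Fintype.card_fin]
  rw [← hc, ← card_powersetCard]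
  refine card_le_card_of_injOn (fun S => S \ {x, y}) ?_ ?_
  · intro S hS
    simp only [coe_filter, mem_powersetCard, Set.mem_ofPred_eq] at hS
    obtain ⟨⟨_, h1⟩, hx, hy⟩ := hS
    simp only [mem_coe, mem_powersetCard]
    refine ⟨sdiff_subset_sdiff (subset_univ _) le_rfl, ?_⟩
    rw [card_sdiff_of_subset, card_pair hxy, h1]
    simp [insert_subset_iff, hx, hy]
  · intro S hS T hT hST
    simp only [coe_filter, Set.mem_ofPred_eq] at hS hT
    have e : ∀ S : Finset (Fin n), x ∈ S → y ∈ S → S \ {x, y} ∪ {x, y} = S := fun S hx hy =>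
      sdiff_union_of_subset (by simp [insert_subset_iff, hx, hy])
    rw [← e S hS.2.1 hS.2.2, ← e T hT.2.1 hT.2.2]
    simp only at hST
    rw [hST]

lemma card_sub_le {β : Type*} (X : Finset β) (p q r : β → Prop) [DecidablePred p] [DecidablePred q] [DecidablePred r]
    (hpq : ∀ S ∈ X, ¬ r S → (p S → q S)) :
    ((X.filter p).card : ℝ) - (X.filter q).card ≤ (X.filter r).card := by
  have : X.filter p ⊆ X.filter q ∪ X.filter r := by
    intro S hS
    simp only [mem_filter, mem_union] at hS ⊢
    by_cases hr : r S
    · exact Or.inr ⟨hS.1, hr⟩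
    · exact Or.inl ⟨hS.1, hpq S hS.1 hr hS.2⟩
  have h2 := (card_le_card this).trans (card_union_le _ _)
  have h3 : ((X.filter p).card : ℝ) ≤ (X.filter q).card + (X.filter r).card := by exact_mod_cast h2
  linarith

lemma inducedDensity_eq (h : ℕ) (H : SimpleGraph (Fin h)) (n : ℕ) (G : SimpleGraph (Fin n)) :
    inducedDensity H G = ((((univ : Finset (Fin n)).powersetCard h).filter
      (fun S : Finset (Fin n) => Nonempty (H ≃g G.induce (S : Set (Fin n))))).card : ℝ) / n.choose h := by
  unfold inducedDensity
  rw [card_powersetCard, card_univ, Fintype.card_fin, Fintype.card_fin]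
  congr 2
  symm
  refine card_bij (fun S _ => (S : Set (Fin n))) ?_ ?_ ?_
  · intro S hS
    simp only [mem_filter, Finset.bind_def, Finset.pure_def, mem_sup, mem_singleton] at hS ⊢
    exact ⟨⟨S, hS.1, rfl⟩, hS.2⟩
  · intro S _ T _ hST
    exact coe_injective hST
  · intro S hS
    simp only [mem_filter, Finset.bind_def, Finset.pure_def, mem_sup, mem_singleton] at hS ⊢
    obtain ⟨⟨T, hT, rfl⟩, h2⟩ := hS
    exact ⟨T, ⟨hT, h2⟩, rfl⟩

lemma density_lip (h : ℕ) (H : SimpleGraph (Fin h)) (n : ℕ) (hn : h ≤ n) (h2 : 2 ≤ h)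
    (G G' : SimpleGraph (Fin n)) (x y : Fin n) (hxy : x ≠ y)
    (hG : ∀ a b, ¬ ((a = x ∧ b = y) ∨ (a = y ∧ b = x)) → (G.Adj a b ↔ G'.Adj a b)) :
    |inducedDensity H G - inducedDensity H G'| ≤ (h.choose 2 : ℝ) / n.choose 2 := by
  have hnh : 0 < (n.choose h : ℝ) := by exact_mod_cast Nat.choose_pos hn
  have hn2 : 0 < (n.choose 2 : ℝ) := by exact_mod_cast Nat.choose_pos (h2.trans hn)
  have hid : (h.choose 2 : ℝ) / n.choose 2 = ((n - 2).choose (h - 2) : ℕ) / (n.choose h : ℝ) := by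
    rw [div_eq_div_iff hn2.ne' hnh.ne']
    have := Nat.choose_mul (n := n) (k := h) (s := 2) h2
    have h3 : ((n.choose h * h.choose 2 : ℕ) : ℝ) = (n.choose 2 * (n - 2).choose (h - 2) : ℕ) := by
      rw [this]
    push_cast at h3
    linarith
  have hind : ∀ S : Finset (Fin n), ¬ (x ∈ S ∧ y ∈ S) →
      G.induce (S : Set (Fin n)) = G'.induce (S : Set (Fin n)) := by
    intro S hS
    ext ⟨a, ha⟩ ⟨b, hb⟩
    simp only [SimpleGraph.comap_adj, Function.Embedding.subtype_apply]
    refine hG a b ?_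
    rintro (⟨rfl, rfl⟩ | ⟨rfl, rfl⟩)
    · exact hS ⟨ha, hb⟩
    · exact hS ⟨hb, ha⟩
  have hcc : ((((univ : Finset (Fin n)).powersetCard (Fintype.card (Fin h))).filter
      (fun S => x ∈ S ∧ y ∈ S)).card : ℝ) ≤ ((n - 2).choose (h - 2) : ℕ) := by
    rw [Fintype.card_fin]
    exact_mod_cast card_containing n h x y hxy
  rw [hid]
  rw [inducedDensity_eq, inducedDensity_eq, ← sub_div, abs_div, abs_of_pos hnh]
  rw [Fintype.card_fin] at hcc
  gcongr
  rw [abs_le]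
  constructor
  · have := card_sub_le ((univ : Finset (Fin n)).powersetCard h)
      (fun S : Finset (Fin n) => Nonempty (H ≃g G'.induce (S : Set (Fin n))))
      (fun S : Finset (Fin n) => Nonempty (H ≃g G.induce (S : Set (Fin n)))) (fun S => x ∈ S ∧ y ∈ S)
      (fun S _ hr hp => by rwa [hind S hr])
    linarith
  · have := card_sub_le ((univ : Finset (Fin n)).powersetCard h)
      (fun S : Finset (Fin n) => Nonempty (H ≃g G.induce (S : Set (Fin n))))
      (fun S : Finset (Fin n) => Nonempty (H ≃g G'.induce (S : Set (Fin n)))) (fun S => x ∈ S ∧ y ∈ S)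
      (fun S _ hr hp => by rwa [← hind S hr])
    linarith

lemma graphProb_nonneg (n : ℕ) (P : Fin n → Fin n → ℝ)
    (hrange : ∀ i j, P i j ∈ Set.Icc (0 : ℝ) 1) (G : SimpleGraph (Fin n)) :
    0 ≤ graphProb n P G := by
  refine prod_nonneg fun e _ => ?_
  have := hrange e.1 e.2
  split_ifs
  · exact this.1
  · linarith [this.2]

lemma graph_mgf (h : ℕ) (H : SimpleGraph (Fin h)) (n : ℕ) (hn : h ≤ n) (h2 : 2 ≤ h)
    (P : Fin n → Fin n → ℝ) (hrange : ∀ i j, P i j ∈ Set.Icc (0 : ℝ) 1) (s : ℝ) :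
    ∑ G, graphProb n P G * Real.exp (s * (inducedDensity H G - expDensity n P H)) ≤
      Real.exp (n.choose 2 * (s ^ 2 * ((h.choose 2 : ℝ) / n.choose 2) ^ 2 / 2)) := by
  unfold expDensity
  rw [graph_sum n P (fun G => inducedDensity H G),
    graph_sum n P (fun G => Real.exp (s * (inducedDensity H G - _))), ← card_pairs n]
  refine mgf_bound (fun p : Fin n × Fin n => P p.1 p.2) (fun e => hrange _ _) s _ _
    (fun A => inducedDensity H (SimpleGraph.fromRel (fun x y => (x, y) ∈ A))) ?_
  rintro ⟨x, y⟩ he A hA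
  have hlt : x < y := by simpa using he
  rw [card_pairs]
  refine density_lip h H n hn h2 _ _ x y hlt.ne fun a b hab => ?_
  simp only [SimpleGraph.fromRel_adj, mem_insert, Prod.mk.injEq]
  tauto

/-- Azuma-type concentration: for a graph `H` on `h` vertices and a symmetric matrix `Π`
with entries in `[0,1]` and zero diagonal (`n ≥ h`),
`Pr[|d(H;G) - E d(H;G)| ≥ 1/√n] ≤ 2 exp(-C(n,2)/(2n C(h,2)²))`. -/
theorem density_concentration (h : ℕ) (H : SimpleGraph (Fin h)) (n : ℕ) (hn : h ≤ n)
    (P : Fin n → Fin n → ℝ)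
    (hsymm : ∀ i j, P i j = P j i) (hrange : ∀ i j, P i j ∈ Set.Icc (0 : ℝ) 1)
    (hdiag : ∀ i, P i i = 0) :
    eventProb n P (fun G => 1 / Real.sqrt n ≤ |inducedDensity H G - expDensity n P H|) ≤
      2 * Real.exp (-(n.choose 2 : ℝ) / (2 * n * ((h.choose 2 : ℝ)) ^ 2)) := by
  have hmass : ∑ G, graphProb n P G = 1 := by
    have := graph_sum n P (fun _ => 1)
    simpa [bw_sum_one] using this
  have hnn := graphProb_nonneg n P hrange
  by_cases h2 : 2 ≤ h
  swap
  · have hc : h.choose 2 = 0 := Nat.choose_eq_zero_of_lt (by omega)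
    rw [hc]
    simp only [Nat.cast_zero, ne_eq, OfNat.ofNat_ne_zero, not_false_eq_true, zero_pow, mul_zero,
      div_zero, Real.exp_zero, mul_one]
    have : eventProb n P (fun G => 1 / Real.sqrt n ≤ |inducedDensity H G - expDensity n P H|) ≤ 1 := by
      rw [← hmass]
      exact sum_le_sum_of_subset_of_nonneg (filter_subset _ _) fun G _ _ => hnn G
    linarith
  have hn0 : 0 < (n : ℝ) := by
    have : 0 < n := by omega
    exact_mod_cast this
  have hN : 0 < (n.choose 2 : ℝ) := by exact_mod_cast Nat.choose_pos (h2.trans hn)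
  have hM : 0 < (h.choose 2 : ℝ) := by exact_mod_cast Nat.choose_pos h2
  set N := (n.choose 2 : ℝ) with hNd
  set M := (h.choose 2 : ℝ) with hMd
  set t := 1 / Real.sqrt n with ht
  have ht0 : 0 < t := by positivity
  have ht2 : t ^ 2 = 1 / n := by
    rw [ht, div_pow, Real.sq_sqrt hn0.le, one_pow]
  set s := t * N / M ^ 2 with hs
  have hs0 : 0 < s := by positivity
  have m1 := graph_mgf h H n hn h2 P hrange s
  have m2 := graph_mgf h H n hn h2 P hrange (-s)
  rw [neg_sq] at m2
  set μ := expDensity n P H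
  set K := Real.exp (N * (s ^ 2 * (M / N) ^ 2 / 2)) with hK
  have hfin : Real.exp (-(s * t)) * K = Real.exp (-N / (2 * n * M ^ 2)) := by
    rw [hK, ← Real.exp_add]
    congr 1
    have e1 : s * t = t ^ 2 * N / M ^ 2 := by rw [hs]; ring
    have e2 : s ^ 2 = t ^ 2 * N ^ 2 / M ^ 4 := by rw [hs]; field_simp
    rw [e1, e2, ht2]
    field_simp
    ring
  rw [← hfin]
  unfold eventProb
  calc _ ≤ ∑ G ∈ univ.filter (fun G => t ≤ |inducedDensity H G - μ|),
        Real.exp (-(s * t)) * (graphProb n P G * Real.exp (s * (inducedDensity H G - μ)) +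
          graphProb n P G * Real.exp (-s * (inducedDensity H G - μ))) := by
        refine sum_le_sum fun G hG => ?_
        have hG' : t ≤ |inducedDensity H G - μ| := (mem_filter.1 hG).2
        set X := inducedDensity H G - μ
        rw [← mul_add, mul_left_comm, mul_add, ← Real.exp_add, ← Real.exp_add]
        refine le_mul_of_one_le_right (hnn G) ?_
        rcases le_abs.1 hG' with hx | hx
        · have : 1 ≤ Real.exp (-(s * t) + s * X) := Real.one_le_exp (by nlinarith)
          linarith [Real.exp_pos (-(s * t) + -s * X)]
        · have : 1 ≤ Real.exp (-(s * t) + -s * X) := Real.one_le_exp (by nlinarith)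
          linarith [Real.exp_pos (-(s * t) + s * X)]
    _ ≤ ∑ G, Real.exp (-(s * t)) * (graphProb n P G * Real.exp (s * (inducedDensity H G - μ)) +
          graphProb n P G * Real.exp (-s * (inducedDensity H G - μ))) := by
        refine sum_le_sum_of_subset_of_nonneg (filter_subset _ _) fun G _ _ => ?_
        have := hnn G
        positivity
    _ ≤ Real.exp (-(s * t)) * (K + K) := by
        rw [← mul_sum, sum_add_distrib]
        gcongr
    _ = _ := by ring
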